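/- arXiv:1306.4743 — 4 statements merged into one kernel-verified Lean document; each statement's English description precedes it below -/
import Mathlib

section
/- Let h > 0, F > 0 and m = (m₁, m₂, m₃) ∈ ℝ³, and define g(U) = Σ_{a=1}^{3} (max(U − m_a, 0))² for U ∈ ℝ. Then there exists exactly one real number U with U > min(m₁, m₂, m₃) and g(U) = h²/F². -/
theorem monotone_max_sub_zero_sq (m : ℝ) : Monotone fun U : ℝ => max (U - m) 0 ^ 2 := by
  intro x y hxy
  have : max (x - m) 0 ≤ max (y - m) 0 := max_le_max (by linarith) le_rfl
  exact pow_le_pow_left₀ (le_max_right _ _) this 2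

theorem strictMonoOn_max_sub_zero_sq (m : ℝ) :
    StrictMonoOn (fun U : ℝ => max (U - m) 0 ^ 2) (Set.Ici m) := by
  intro x hx y hy hxy
  simp only [Set.mem_Ici] at hx hy
  simp only [max_eq_left (sub_nonneg.2 hx), max_eq_left (sub_nonneg.2 hy)]
  exact pow_lt_pow_left₀ (by linarith) (by linarith) two_ne_zero

theorem strictMonoOn_upwind_sum (m₁ m₂ m₃ : ℝ) :
    StrictMonoOn
      (fun U : ℝ => max (U - m₁) 0 ^ 2 + max (U - m₂) 0 ^ 2 + max (U - m₃) 0 ^ 2)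
      (Set.Ici (min m₁ (min m₂ m₃))) := by
  intro x hx y hy hxy
  have h₁ := monotone_max_sub_zero_sq m₁ hxy.le
  have h₂ := monotone_max_sub_zero_sq m₂ hxy.le
  have h₃ := monotone_max_sub_zero_sq m₃ hxy.le
  simp only [Set.mem_Ici, min_le_iff] at hx
  dsimp only at h₁ h₂ h₃ ⊢
  rcases hx with hx | hx | hx <;>
  · have := strictMonoOn_max_sub_zero_sq _ hx (hx.trans hxy.le) hxy
    dsimp only at this
    linarith

theorem upwind_sum_min_eq_zero (m₁ m₂ m₃ : ℝ) :
    max (min m₁ (min m₂ m₃) - m₁) 0 ^ 2 + max (min m₁ (min m₂ m₃) - m₂) 0 ^ 2 +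
      max (min m₁ (min m₂ m₃) - m₃) 0 ^ 2 = 0 := by
  rw [max_eq_right, max_eq_right, max_eq_right] <;> simp

theorem sq_le_upwind_sum_min_add (m₁ m₂ m₃ : ℝ) {t : ℝ} (ht : 0 ≤ t) :
    t ^ 2 ≤ max (min m₁ (min m₂ m₃) + t - m₁) 0 ^ 2 +
      max (min m₁ (min m₂ m₃) + t - m₂) 0 ^ 2 +
      max (min m₁ (min m₂ m₃) + t - m₃) 0 ^ 2 := by
  have key (M m : ℝ) (hM : M = m) : t ^ 2 = max (M + t - m) 0 ^ 2 := by
    rw [hM, add_sub_cancel_left, max_eq_left ht]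
  have hcases : min m₁ (min m₂ m₃) = m₁ ∨ min m₁ (min m₂ m₃) = m₂ ∨
      min m₁ (min m₂ m₃) = m₃ := by
    rcases min_choice m₁ (min m₂ m₃) with h | h
    · exact Or.inl h
    · rw [h]
      exact Or.inr (min_choice m₂ m₃)
  generalize min m₁ (min m₂ m₃) = M at hcases ⊢
  have h₁ := sq_nonneg (max (M + t - m₁) 0)
  have h₂ := sq_nonneg (max (M + t - m₂) 0)
  have h₃ := sq_nonneg (max (M + t - m₃) 0)
  rcases hcases with h | h | h <;> linarith [key _ _ h]

/-- For h > 0, F > 0 and m = (m₁, m₂, m₃) ∈ ℝ³, with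
g(U) = Σ_{a=1}^{3} (max(U − m_a, 0))², there exists exactly one real U with
U > min(m₁, m₂, m₃) and g(U) = h²/F². -/
theorem upwind_update_exists_unique (h F m₁ m₂ m₃ : ℝ) (hh : 0 < h) (hF : 0 < F) :
    ∃! U : ℝ, U > min m₁ (min m₂ m₃) ∧
      max (U - m₁) 0 ^ 2 + max (U - m₂) 0 ^ 2 + max (U - m₃) 0 ^ 2 = h ^ 2 / F ^ 2 := by
  have hpos : 0 < h / F := div_pos hh hF
  have hsq : 0 < (h / F) ^ 2 := pow_pos hpos 2
  have hmono := strictMonoOn_upwind_sum m₁ m₂ m₃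
  have hzero := upwind_sum_min_eq_zero m₁ m₂ m₃
  have hlarge := sq_le_upwind_sum_min_add m₁ m₂ m₃ hpos.le
  rw [← div_pow]
  obtain ⟨U, hU, hgU⟩ := intermediate_value_Icc
    (f := fun U : ℝ => max (U - m₁) 0 ^ 2 + max (U - m₂) 0 ^ 2 + max (U - m₃) 0 ^ 2)
    (le_add_of_nonneg_right hpos.le : min m₁ (min m₂ m₃) ≤ min m₁ (min m₂ m₃) + h / F)
    (by fun_prop) ⟨hzero.le.trans hsq.le, hlarge⟩
  refine ⟨U, ⟨lt_of_le_of_ne hU.1 ?_, hgU⟩, fun V hV => ?_⟩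
  · rintro rfl
    exact hsq.ne (hzero.symm.trans hgU)
  · exact hmono.injOn hV.1.le hU.1 (hV.2.trans hgU.symm)
end

section
/- Let h > 0, F > 0 and m, m' ∈ ℝ³, and let Û(m) denote the unique real number U with U > min(m₁, m₂, m₃) and Σ_{a=1}^{3} (max(U − m_a, 0))² = h²/F². If m'_a = m_a for every index a with m_a < Û(m), and m'_a ≥ Û(m) for every index a with m_a ≥ Û(m), then Û(m') = Û(m). In other words, the upwind update value depends only on those inputs m_a that are strictly smaller than it; inputs that are not smaller may be changed arbitrarily (as long as they stay ≥ Û(m)) without affecting the value. -/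
theorem max_sub_zero_sq_le {m V W : ℝ} (hVW : V ≤ W) :
    max (V - m) 0 ^ 2 ≤ max (W - m) 0 ^ 2 := by
  gcongr

theorem max_sub_zero_sq_lt {m V W : ℝ} (hVW : V < W) (hm : m < W) :
    max (V - m) 0 ^ 2 < max (W - m) 0 ^ 2 := by
  have hlt : max (V - m) 0 < max (W - m) 0 := by
    rw [max_eq_left (sub_pos.2 hm).le]
    exact max_lt (by linarith) (sub_pos.2 hm)
  exact pow_lt_pow_left₀ hlt (le_max_right _ _) two_ne_zero

/-- The upwind sum of squares is strictly increasing up to any value above the least input. -/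
theorem upwind_sum_lt {m₁ m₂ m₃ V W : ℝ} (hVW : V < W) (hm : min m₁ (min m₂ m₃) < W) :
    max (V - m₁) 0 ^ 2 + max (V - m₂) 0 ^ 2 + max (V - m₃) 0 ^ 2 <
      max (W - m₁) 0 ^ 2 + max (W - m₂) 0 ^ 2 + max (W - m₃) 0 ^ 2 := by
  have l₁ := max_sub_zero_sq_le (m := m₁) hVW.le
  have l₂ := max_sub_zero_sq_le (m := m₂) hVW.le
  have l₃ := max_sub_zero_sq_le (m := m₃) hVW.le
  rcases min_lt_iff.1 hm with h | h
  · linarith [max_sub_zero_sq_lt hVW h]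
  · rcases min_lt_iff.1 h with h | h <;> linarith [max_sub_zero_sq_lt hVW h]

theorem max_sub_zero_congr {m m' U : ℝ} (h : m < U → m' = m) (h' : m ≥ U → m' ≥ U) :
    max (U - m') 0 = max (U - m) 0 := by
  rcases lt_or_ge m U with hm | hm
  · rw [h hm]
  · rw [max_eq_right (sub_nonpos.2 (h' hm)), max_eq_right (sub_nonpos.2 hm)]

/-- Inputs below `U` are kept, so the least input stays below `U`. -/
theorem min_lt_of_agree {m₁ m₂ m₃ m₁' m₂' m₃' U : ℝ} (hm : min m₁ (min m₂ m₃) < U)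
    (h1 : m₁ < U → m₁' = m₁) (h2 : m₂ < U → m₂' = m₂) (h3 : m₃ < U → m₃' = m₃) :
    min m₁' (min m₂' m₃') < U := by
  simp only [min_lt_iff] at hm ⊢
  exact hm.imp (fun h => (h1 h).trans_lt h)
    (Or.imp (fun h => (h2 h).trans_lt h) (fun h => (h3 h).trans_lt h))

/-- Causality of the upwind update. If U = Û(m) and U' = Û(m'),
where m'_a = m_a for every index a with m_a < Û(m), and m'_a ≥ Û(m) for every
index a with m_a ≥ Û(m), then Û(m') = Û(m). -/
theorem upwind_update_causality (h F m₁ m₂ m₃ m₁' m₂' m₃' U U' : ℝ)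
    (hh : 0 < h) (hF : 0 < F)
    (hU : U > min m₁ (min m₂ m₃) ∧
      max (U - m₁) 0 ^ 2 + max (U - m₂) 0 ^ 2 + max (U - m₃) 0 ^ 2 = h ^ 2 / F ^ 2)
    (hU' : U' > min m₁' (min m₂' m₃') ∧
      max (U' - m₁') 0 ^ 2 + max (U' - m₂') 0 ^ 2 + max (U' - m₃') 0 ^ 2 = h ^ 2 / F ^ 2)
    (h1 : m₁ < U → m₁' = m₁) (h1' : m₁ ≥ U → m₁' ≥ U)
    (h2 : m₂ < U → m₂' = m₂) (h2' : m₂ ≥ U → m₂' ≥ U)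
    (h3 : m₃ < U → m₃' = m₃) (h3' : m₃ ≥ U → m₃' ≥ U) :
    U' = U := by
  have hmin := min_lt_of_agree hU.1 h1 h2 h3
  have hsum := hU.2
  rw [← max_sub_zero_congr h1 h1', ← max_sub_zero_congr h2 h2',
    ← max_sub_zero_congr h3 h3'] at hsum
  rcases lt_trichotomy U' U with hlt | heq | hgt
  · exact absurd (hU'.2.trans hsum.symm) (upwind_sum_lt hlt hmin).ne
  · exact heq
  · exact absurd (hsum.trans hU'.2.symm) (upwind_sum_lt hgt hU'.1).ne
end

section
/- Let h > 0, F > 0 and m, m' ∈ ℝ³, and let Û(m) denote the unique real number U with U > min(m₁, m₂, m₃) and Σ_{a=1}^{3} (max(U − m_a, 0))² = h²/F², and similarly for Û(m'). Then |Û(m) − Û(m')| ≤ max_{a=1,2,3} |m_a − m'_a|; i.e., the upwind update operator is nonexpansive in the maximum norm. -/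
/-- The squared positive part is strictly monotone where it is positive. -/
theorem max_zero_sq_lt_max_zero_sq {x y : ℝ} (hxy : x < y) (hy : 0 < y) :
    max x 0 ^ 2 < max y 0 ^ 2 :=
  pow_lt_pow_left₀ (by simp [hxy, hy]) (le_max_right _ _) two_ne_zero

/-- The squared positive part is monotone. -/
theorem max_zero_sq_le_max_zero_sq {x y : ℝ} (hxy : x ≤ y) : max x 0 ^ 2 ≤ max y 0 ^ 2 :=
  pow_le_pow_left₀ (le_max_right _ _) (max_le_max_right 0 hxy) 2

/-- If every neighbor value increases by at most `d`, so does the upwind update. -/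
theorem upwind_update_sub_le {m₁ m₂ m₃ m₁' m₂' m₃' U U' d : ℝ}
    (hU : min m₁ (min m₂ m₃) < U)
    (heq : max (U - m₁) 0 ^ 2 + max (U - m₂) 0 ^ 2 + max (U - m₃) 0 ^ 2 =
      max (U' - m₁') 0 ^ 2 + max (U' - m₂') 0 ^ 2 + max (U' - m₃') 0 ^ 2)
    (h₁ : m₁ - m₁' ≤ d) (h₂ : m₂ - m₂' ≤ d) (h₃ : m₃ - m₃' ≤ d) : U - U' ≤ d := by
  by_contra! hd
  have l₁ : U' - m₁' < U - m₁ := by linarith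
  have l₂ : U' - m₂' < U - m₂ := by linarith
  have l₃ : U' - m₃' < U - m₃ := by linarith
  have k₁ := max_zero_sq_le_max_zero_sq l₁.le
  have k₂ := max_zero_sq_le_max_zero_sq l₂.le
  have k₃ := max_zero_sq_le_max_zero_sq l₃.le
  simp only [min_lt_iff] at hU
  rcases hU with hm | hm | hm
  · linarith [max_zero_sq_lt_max_zero_sq l₁ (sub_pos.2 hm)]
  · linarith [max_zero_sq_lt_max_zero_sq l₂ (sub_pos.2 hm)]
  · linarith [max_zero_sq_lt_max_zero_sq l₃ (sub_pos.2 hm)]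

/-- The upwind update operator is nonexpansive in the maximum norm:
|Û(m) − Û(m')| ≤ max_{a=1,2,3} |m_a − m'_a|. -/
theorem upwind_update_nonexpansive (h F m₁ m₂ m₃ m₁' m₂' m₃' U U' : ℝ)
    (hh : 0 < h) (hF : 0 < F)
    (hU : U > min m₁ (min m₂ m₃) ∧
      max (U - m₁) 0 ^ 2 + max (U - m₂) 0 ^ 2 + max (U - m₃) 0 ^ 2 = h ^ 2 / F ^ 2)
    (hU' : U' > min m₁' (min m₂' m₃') ∧
      max (U' - m₁') 0 ^ 2 + max (U' - m₂') 0 ^ 2 + max (U' - m₃') 0 ^ 2 = h ^ 2 / F ^ 2) :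
    |U - U'| ≤ max |m₁ - m₁'| (max |m₂ - m₂'| |m₃ - m₃'|) := by
  have b₁ : |m₁ - m₁'| ≤ max |m₁ - m₁'| (max |m₂ - m₂'| |m₃ - m₃'|) := le_max_left _ _
  have b₂ : |m₂ - m₂'| ≤ max |m₁ - m₁'| (max |m₂ - m₂'| |m₃ - m₃'|) :=
    (le_max_left _ _).trans (le_max_right _ _)
  have b₃ : |m₃ - m₃'| ≤ max |m₁ - m₁'| (max |m₂ - m₂'| |m₃ - m₃'|) :=
    (le_max_right _ _).trans (le_max_right _ _)
  refine abs_sub_le_iff.2 ⟨?_, ?_⟩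
  · exact upwind_update_sub_le hU.1 (hU.2.trans hU'.2.symm)
      (abs_sub_le_iff.1 b₁).1 (abs_sub_le_iff.1 b₂).1 (abs_sub_le_iff.1 b₃).1
  · exact upwind_update_sub_le hU'.1 (hU'.2.trans hU.2.symm)
      (abs_sub_le_iff.1 b₁).2 (abs_sub_le_iff.1 b₂).2 (abs_sub_le_iff.1 b₃).2
end

section
/- Let n ≥ 1, X = {0, 1, …, n}³, h > 0, let Q ⊆ X be nonempty, let q : Q → ℝ, and let F : X → ℝ satisfy F(x) > 0 for all x. Then the discretized Eikonal system has exactly one solution U : X → ℝ; i.e., there is exactly one U with U = q on Q and Σ_{a=1}^{3} (max(U(x) − m_a(U, x), 0))² = h²/F(x)² for every x ∈ X \ Q. -/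
/-- The grid X = {0, 1, …, n}³, represented as functions Fin 3 → Fin (n+1). -/
abbrev Grid (n : ℕ) := Fin 3 → Fin (n + 1)

/-- `y` is a grid neighbor of `x` along axis `a`: they agree in all other
coordinates and differ by exactly 1 in coordinate `a`. -/
def AxisNbr {n : ℕ} (a : Fin 3) (x y : Grid n) : Prop :=
  (∀ b, b ≠ a → y b = x b) ∧ ((y a : ℤ) - (x a : ℤ)).natAbs = 1

/-- m_a(U, x): the minimum of U over the grid neighbors of x along axis a. -/
noncomputable def axMin {n : ℕ} (U : Grid n → ℝ) (x : Grid n) (a : Fin 3) : ℝ :=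
  sInf {v | ∃ y : Grid n, AxisNbr a x y ∧ U y = v}

/-- U solves the discretized Eikonal system with stepsize `hs`, exit set `Q`,
exit penalty `q`, and speed `F`. -/
def SolvesEikonal {n : ℕ} (hs : ℝ) (Q : Set (Grid n)) (q F U : Grid n → ℝ) : Prop :=
  (∀ x ∈ Q, U x = q x) ∧
  ∀ x : Grid n, x ∉ Q →
    ∑ a : Fin 3, max (U x - axMin U x a) 0 ^ 2 = hs ^ 2 / F x ^ 2

theorem AxisNbr.ne {n : ℕ} {a : Fin 3} {x y : Grid n} (h : AxisNbr a x y) : y ≠ x := by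
  rintro rfl
  simpa using h.2

theorem exists_axisNbr {n : ℕ} (hn : 1 ≤ n) (x : Grid n) (a : Fin 3) :
    ∃ y, AxisNbr a x y := by
  have hx := (x a).isLt
  by_cases h0 : (x a : ℕ) = 0
  · refine ⟨Function.update x a ⟨1, by omega⟩, fun b hb => Function.update_of_ne hb _ _, ?_⟩
    simp [h0]
  · refine ⟨Function.update x a ⟨x a - 1, by omega⟩, fun b hb => Function.update_of_ne hb _ _, ?_⟩
    simp only [Function.update_self]
    omega

theorem axMin_le {n : ℕ} (U : Grid n → ℝ) {x y : Grid n} {a : Fin 3} (h : AxisNbr a x y) :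
    axMin U x a ≤ U y :=
  csInf_le ((Set.finite_range U).subset (by rintro _ ⟨z, -, rfl⟩; exact ⟨z, rfl⟩)).bddBelow
    ⟨y, h, rfl⟩

theorem exists_eq_axMin {n : ℕ} (hn : 1 ≤ n) (U : Grid n → ℝ) (x : Grid n) (a : Fin 3) :
    ∃ y, AxisNbr a x y ∧ U y = axMin U x a := by
  obtain ⟨y, hy⟩ := exists_axisNbr hn x a
  have hne : {v | ∃ y : Grid n, AxisNbr a x y ∧ U y = v}.Nonempty := ⟨U y, y, hy, rfl⟩
  exact hne.csInf_mem
    ((Set.finite_range U).subset (by rintro _ ⟨z, -, rfl⟩; exact ⟨z, rfl⟩))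

theorem axMin_mono {n : ℕ} (hn : 1 ≤ n) {U V : Grid n → ℝ} {x : Grid n} {a : Fin 3}
    (h : ∀ y, AxisNbr a x y → U y ≤ V y) : axMin U x a ≤ axMin V x a := by
  obtain ⟨y, hy, hVy⟩ := exists_eq_axMin hn V x a
  exact hVy ▸ (axMin_le U hy).trans (h y hy)

theorem axMin_update_self {n : ℕ} (hn : 1 ≤ n) (U : Grid n → ℝ) (x : Grid n) (t : ℝ)
    (a : Fin 3) : axMin (Function.update U x t) x a = axMin U x a :=
  le_antisymm (axMin_mono hn fun _ hy => (Function.update_of_ne hy.ne t U).le)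
    (axMin_mono hn fun _ hy => (Function.update_of_ne hy.ne t U).ge)

/-- The upwind squared gradient at `x` of a grid function taking the value `t` at `x` and
agreeing with `U` at the neighbors of `x`. -/
noncomputable def upwind {n : ℕ} (U : Grid n → ℝ) (x : Grid n) (t : ℝ) : ℝ :=
  ∑ a : Fin 3, max (t - axMin U x a) 0 ^ 2

theorem continuous_upwind {n : ℕ} (U : Grid n → ℝ) (x : Grid n) : Continuous (upwind U x) := by
  unfold upwind
  fun_prop

theorem upwind_anti {n : ℕ} (hn : 1 ≤ n) {U V : Grid n → ℝ} (h : U ≤ V) (x : Grid n) (t : ℝ) :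
    upwind V x t ≤ upwind U x t := by
  unfold upwind
  gcongr with a
  exact axMin_mono hn fun y _ => h y

/-- Subsolutions of the Eikonal system with squared slowness `c`. -/
def IsSubsolution {n : ℕ} (Q : Set (Grid n)) (q c U : Grid n → ℝ) : Prop :=
  (∀ x ∈ Q, U x ≤ q x) ∧ ∀ x ∉ Q, upwind U x (U x) ≤ c x

/-- Discrete comparison principle. -/
theorem IsSubsolution.le {n : ℕ} (hn : 1 ≤ n) {Q : Set (Grid n)} {q c U V : Grid n → ℝ}
    (hc : ∀ x, 0 < c x) (hU : IsSubsolution Q q c U) (hVQ : ∀ x ∈ Q, q x ≤ V x)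
    (hV : ∀ x ∉ Q, c x ≤ upwind V x (V x)) : U ≤ V := by
  obtain ⟨z, hz⟩ := Finite.exists_max fun x => U x - V x
  by_contra hUV
  obtain ⟨w, hw⟩ : ∃ w, V w < U w := by simpa [Pi.le_def] using hUV
  obtain ⟨x, hxz, hx⟩ := Set.exists_min_image {x | U x - V x = U z - V z} V
    (Set.toFinite _) ⟨z, rfl⟩
  simp only [Set.mem_ofPred_eq] at hxz hx
  have hpos : 0 < U x - V x := by linarith [hz w]
  have hxQ : x ∉ Q := fun h => by linarith [hU.1 x h, hVQ x h]
  have key (a : Fin 3) : V x - axMin V x a ≤ U x - axMin U x a ∧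
      (axMin V x a < V x → V x - axMin V x a < U x - axMin U x a) := by
    obtain ⟨y, hy, hVy⟩ := exists_eq_axMin hn V x a
    have hUy := axMin_le U hy
    have hyz := hz y
    refine ⟨by linarith, fun hlt => ?_⟩
    have hne : U y - V y ≠ U z - V z := fun h => by linarith [hx y h]
    linarith [lt_of_le_of_ne hyz hne]
  obtain ⟨a, ha⟩ : ∃ a, axMin V x a < V x := by
    by_contra! hcon
    have h0 : upwind V x (V x) = 0 := Finset.sum_eq_zero fun a _ => by
      rw [max_eq_right (by linarith [hcon a])]
      norm_num
    linarith [hc x, hV x hxQ]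
  have hlt : upwind V x (V x) < upwind U x (U x) := by
    refine Finset.sum_lt_sum (fun b _ => ?_) ⟨a, Finset.mem_univ a, ?_⟩
    · have := (key b).1
      gcongr
    · have := (key a).2 ha
      rw [max_eq_left (by linarith), max_eq_left (by linarith)]
      exact pow_lt_pow_left₀ this (by linarith) two_ne_zero
  linarith [hU.2 x hxQ, hV x hxQ]

theorem IsSubsolution.update {n : ℕ} (hn : 1 ≤ n) {Q : Set (Grid n)} {q c U : Grid n → ℝ}
    (hU : IsSubsolution Q q c U) {x : Grid n} {t : ℝ} (ht : U x ≤ t) (hxQ : x ∈ Q → t ≤ q x)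
    (hx : x ∉ Q → upwind U x t ≤ c x) : IsSubsolution Q q c (Function.update U x t) := by
  have hle : U ≤ Function.update U x t := by simpa using ht
  refine ⟨fun y hy => ?_, fun y hy => ?_⟩ <;> rcases eq_or_ne y x with rfl | hne
  · simpa using hxQ hy
  · simpa [hne] using hU.1 y hy
  · simpa [upwind, axMin_update_self hn] using hx hy
  · rw [Function.update_of_ne hne]
    exact (upwind_anti hn hle y _).trans (hU.2 y hy)

theorem exists_axisNbr_toward {n : ℕ} {x x₀ : Grid n} (hx : x ≠ x₀) :
    ∃ a y, AxisNbr a x y ∧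
      ∑ b, |((y b : ℕ) : ℝ) - (x₀ b : ℕ)| + 1 ≤ ∑ b, |((x b : ℕ) : ℝ) - (x₀ b : ℕ)| := by
  obtain ⟨a, ha⟩ := Function.ne_iff.1 hx
  have hxa := (x a).isLt
  have hx₀a := (x₀ a).isLt
  have hval : (x a : ℕ) ≠ x₀ a := fun h => ha (Fin.ext h)
  have step (k : Fin (n + 1)) (hk : ((k : ℤ) - (x a : ℤ)).natAbs = 1)
      (hd : |((k : ℕ) : ℝ) - (x₀ a : ℕ)| + 1 ≤ |((x a : ℕ) : ℝ) - (x₀ a : ℕ)|) :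
      ∃ a y, AxisNbr a x y ∧
        ∑ b, |((y b : ℕ) : ℝ) - (x₀ b : ℕ)| + 1 ≤ ∑ b, |((x b : ℕ) : ℝ) - (x₀ b : ℕ)| := by
    refine ⟨a, Function.update x a k, ⟨fun b hb => Function.update_of_ne hb _ _, by simpa⟩, ?_⟩
    rw [← Finset.add_sum_erase _ _ (Finset.mem_univ a),
      ← Finset.add_sum_erase (a := a) _ (fun b => |((x b : ℕ) : ℝ) - (x₀ b : ℕ)|)
        (Finset.mem_univ a),
      Finset.sum_congr rfl fun b hb => by
        rw [Function.update_of_ne (Finset.ne_of_mem_erase hb)]]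
    simp only [Function.update_self]
    linarith
  rcases lt_or_gt_of_ne hval with h | h
  · refine step ⟨x a + 1, by omega⟩ (by simp) ?_
    have h' : ((x a : ℕ) : ℝ) + 1 ≤ (x₀ a : ℕ) := by exact_mod_cast h
    push_cast
    rw [abs_of_nonpos (by linarith), abs_of_nonpos (by linarith)]
    linarith
  · refine step ⟨x a - 1, by omega⟩ (by simp only; omega) ?_
    have h' : ((x₀ a : ℕ) : ℝ) + 1 ≤ (x a : ℕ) := by exact_mod_cast h
    rw [Nat.cast_sub (by omega), Nat.cast_one, abs_of_nonneg (by linarith),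
      abs_of_nonneg (by linarith)]
    linarith

theorem exists_supersolution {n : ℕ} {Q : Set (Grid n)} (hQ : Q.Nonempty) (q c : Grid n → ℝ) :
    ∃ V : Grid n → ℝ, (∀ x ∈ Q, q x ≤ V x) ∧ ∀ x ∉ Q, c x ≤ upwind V x (V x) := by
  obtain ⟨x₀, hx₀⟩ := hQ
  obtain ⟨z, hz⟩ := Finite.exists_max q
  obtain ⟨w, hw⟩ := Finite.exists_max c
  set K := |c w| + 1
  have hK : 1 ≤ K := by simp [K]
  have hcK : ∀ x, c x ≤ K ^ 2 := fun x => by nlinarith [hw x, le_abs_self (c w)]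
  refine ⟨fun x => q z + K * ∑ b, |((x b : ℕ) : ℝ) - (x₀ b : ℕ)|, fun x _ => ?_,
    fun x hx => ?_⟩
  · have : 0 ≤ K * ∑ b, |((x b : ℕ) : ℝ) - (x₀ b : ℕ)| := by positivity
    linarith [hz x]
  · obtain ⟨a, y, hy, hd⟩ := exists_axisNbr_toward (show x ≠ x₀ from fun h => hx (h ▸ hx₀))
    set V : Grid n → ℝ := fun x => q z + K * ∑ b, |((x b : ℕ) : ℝ) - (x₀ b : ℕ)|
    have hVy : V y + K ≤ V x := by
      simp only [V]
      nlinarith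
    have hKle : K ≤ max (V x - axMin V x a) 0 :=
      le_max_of_le_left (by linarith [axMin_le V hy])
    calc c x ≤ K ^ 2 := hcK x
      _ ≤ max (V x - axMin V x a) 0 ^ 2 := by gcongr
      _ ≤ upwind V x (V x) := Finset.single_le_sum
          (f := fun a => max (V x - axMin V x a) 0 ^ 2) (fun _ _ => sq_nonneg _)
          (Finset.mem_univ a)

theorem exists_isSubsolution {n : ℕ} (hn : 1 ≤ n) (Q : Set (Grid n)) (q : Grid n → ℝ)
    {c : Grid n → ℝ} (hc : ∀ x, 0 < c x) : ∃ U, IsSubsolution Q q c U := by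
  obtain ⟨z, hz⟩ := Finite.exists_min q
  refine ⟨fun _ => q z, fun x _ => hz x, fun x _ => (Eq.le ?_).trans (hc x).le⟩
  refine Finset.sum_eq_zero fun a _ => ?_
  obtain ⟨y, -, hy⟩ := exists_eq_axMin hn (fun _ => q z) x a
  simp [← hy]

/-- Perron's method: there is a greatest subsolution. -/
theorem exists_isGreatest_isSubsolution {n : ℕ} (hn : 1 ≤ n) {Q : Set (Grid n)}
    (hQ : Q.Nonempty) (q : Grid n → ℝ) {c : Grid n → ℝ} (hc : ∀ x, 0 < c x) :
    ∃ W, IsGreatest {U | IsSubsolution Q q c U} W := by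
  obtain ⟨V, hVQ, hV⟩ := exists_supersolution hQ q c
  have hne : {U | IsSubsolution Q q c U}.Nonempty := exists_isSubsolution hn Q q hc
  have hbdd (x : Grid n) : BddAbove ((fun U : Grid n → ℝ => U x) '' {U | IsSubsolution Q q c U}) :=
    ⟨V x, by rintro _ ⟨U, hU, rfl⟩; exact IsSubsolution.le hn hc hU hVQ hV x⟩
  set W : Grid n → ℝ := fun x => sSup ((fun U : Grid n → ℝ => U x) '' {U | IsSubsolution Q q c U})
  have hW (U : Grid n → ℝ) (hU : IsSubsolution Q q c U) : U ≤ W :=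
    fun x => le_csSup (hbdd x) ⟨U, hU, rfl⟩
  refine ⟨W, ⟨fun x hx => csSup_le (hne.image _) ?_, fun x hx => ?_⟩, hW⟩
  · rintro _ ⟨U, hU, rfl⟩
    exact hU.1 x hx
  · refine closure_minimal ?_ (isClosed_le (continuous_upwind W x) continuous_const)
      (csSup_mem_closure (hne.image _) (hbdd x))
    rintro _ ⟨U, hU, rfl⟩
    exact (upwind_anti hn (hW U hU) x _).trans (hU.2 x hx)

/-- The discretized Eikonal system has exactly one solution. -/
theorem eikonal_system_exists_unique (n : ℕ) (hn : 1 ≤ n) (hs : ℝ) (hhs : 0 < hs)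
    (Q : Set (Grid n)) (hQ : Q.Nonempty) (q F : Grid n → ℝ) (hF : ∀ x, 0 < F x) :
    ∃! U : Grid n → ℝ, SolvesEikonal hs Q q F U := by
  set c : Grid n → ℝ := fun x => hs ^ 2 / F x ^ 2
  have hc (x : Grid n) : 0 < c x := by
    have := hF x
    positivity
  obtain ⟨W, hW, hmax⟩ := exists_isGreatest_isSubsolution hn hQ q hc
  have hbump (x : Grid n) (t : ℝ) (ht : W x < t) (hxQ : x ∈ Q → t ≤ q x)
      (hx : x ∉ Q → upwind W x t ≤ c x) : False := by
    have := hmax (hW.update hn ht.le hxQ hx) x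
    rw [Function.update_self] at this
    linarith
  refine ⟨W, ⟨fun x hx => ?_, fun x hx => ?_⟩, fun V hV => ?_⟩
  · refine (hW.1 x hx).eq_of_not_lt fun hlt => ?_
    exact hbump x (q x) hlt (fun _ => le_rfl) fun h => (h hx).elim
  · refine (hW.2 x hx).eq_of_not_lt fun hlt => ?_
    have hev := (continuous_upwind W x).continuousAt.eventually_lt_const hlt
    obtain ⟨t, ht, hWt⟩ := ((hev.filter_mono nhdsWithin_le_nhds).and
      (self_mem_nhdsWithin : Set.Ioi (W x) ∈ nhdsWithin (W x) (Set.Ioi (W x)))).exists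
    exact hbump x t hWt (fun h => (hx h).elim) fun _ => ht.le
  · exact le_antisymm (hmax ⟨fun x hx => (hV.1 x hx).le, fun x hx => (hV.2 x hx).le⟩)
      (hW.le hn hc (fun x hx => (hV.1 x hx).ge) fun x hx => (hV.2 x hx).ge)
end
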